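/- Let R be a finite set, let q : R → ℝ be nonnegative weights with ∑_{r ∈ R} q r = 1, and let a, b, c : R → (ℤ/2ℤ → ℤ/2ℤ) be families of local strategies. Say strategy r succeeds on input (s,t,u) if a r s + b r t + c r u = 0 when (s,t,u) = (0,0,0), and a r s + b r t + c r u = 1 when (s,t,u) ∈ {(0,1,1),(1,0,1),(1,1,0)}. Then ∑_{r ∈ R} q r · (number of the four promise inputs on which r succeeds)/4 ≤ 3/4. That is, every probabilistic classical strategy for the GHZ game succeeds with probability at most 3/4 under the uniform distribution on promise inputs. -/

import Mathlib

open Finset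

/-- A deterministic strategy wins on at most three of the four promise inputs. -/
theorem ghz_card_le (a b c : ZMod 2 → ZMod 2) :
    (({((0 : ZMod 2), (0 : ZMod 2), (0 : ZMod 2)), (0, 1, 1), (1, 0, 1), (1, 1, 0)} :
              Finset (ZMod 2 × ZMod 2 × ZMod 2)).filter
            (fun stu => a stu.1 + b stu.2.1 + c stu.2.2 =
              if stu = (0, 0, 0) then 0 else 1)).card ≤ 3 := by
  have hlt := Finset.card_lt_card (s := ({((0 : ZMod 2), (0 : ZMod 2), (0 : ZMod 2)), (0, 1, 1),
      (1, 0, 1), (1, 1, 0)} : Finset (ZMod 2 × ZMod 2 × ZMod 2)).filter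
            (fun stu => a stu.1 + b stu.2.1 + c stu.2.2 =
              if stu = (0, 0, 0) then 0 else 1))
      (t := {((0 : ZMod 2), (0 : ZMod 2), (0 : ZMod 2)), (0, 1, 1), (1, 0, 1), (1, 1, 0)}) (by
    rw [Finset.filter_ssubset]
    by_contra! h
    have h0 := h (0, 0, 0) (by decide)
    have h1 := h (0, 1, 1) (by decide)
    have h2 := h (1, 0, 1) (by decide)
    have h3 := h (1, 1, 0) (by decide)
    rw [if_pos rfl] at h0
    rw [if_neg (by decide)] at h1 h2 h3
    dsimp only at h0 h1 h2 h3
    generalize a 0 = a0 at *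
    generalize a 1 = a1 at *
    generalize b 0 = b0 at *
    generalize b 1 = b1 at *
    generalize c 0 = c0 at *
    generalize c 1 = c1 at *
    clear h
    revert a0 a1 b0 b1 c0 c1
    decide)
  have hc : ({((0 : ZMod 2), (0 : ZMod 2), (0 : ZMod 2)), (0, 1, 1), (1, 0, 1), (1, 1, 0)} :
      Finset (ZMod 2 × ZMod 2 × ZMod 2)).card = 4 := by decide
  omega

/-- Every probabilistic classical strategy for the GHZ game succeeds with
probability at most 3/4 under the uniform distribution on the four promise
inputs. -/
theorem ghz_probabilistic_bound (R : Type) [Fintype R]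
    (q : R → ℝ) (hq : ∀ r, 0 ≤ q r) (hsum : ∑ r, q r = 1)
    (a b c : R → ZMod 2 → ZMod 2) :
    ∑ r, q r *
        (((({((0 : ZMod 2), (0 : ZMod 2), (0 : ZMod 2)), (0, 1, 1), (1, 0, 1), (1, 1, 0)} :
              Finset (ZMod 2 × ZMod 2 × ZMod 2)).filter
            (fun stu => a r stu.1 + b r stu.2.1 + c r stu.2.2 =
              if stu = (0, 0, 0) then 0 else 1)).card : ℝ) / 4)
      ≤ 3 / 4 := by
  calc _ ≤ ∑ r, q r * (3 / 4) := by
        refine Finset.sum_le_sum fun r _ => mul_le_mul_of_nonneg_left ?_ (hq r)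
        have h : _ ≤ ((3 : ℕ) : ℝ) := Nat.cast_le.mpr (ghz_card_le (a r) (b r) (c r))
        push_cast at h
        linarith
    _ = 3 / 4 := by rw [← Finset.sum_mul, hsum, one_mul]
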